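/- Let x be a point in the interior of S³ with lim_{n→∞} φ(Vⁿx) = 0. Then for every sufficiently small ε > 0 the average time the trajectory spends outside the ε-neighborhoods of the four vertices is zero: lim_{n→∞} (1/n) · #{0 ≤ k < n : (V^k x)_i < 1 − ε for every i = 1,2,3,4} = 0. -/

import Mathlib

/-- The three-dimensional simplex `S³ ⊆ ℝ⁴`. -/
def simplex3 : Set (Fin 4 → ℝ) := {x | (∀ i, 0 ≤ x i) ∧ ∑ i, x i = 1}

/-- The Volterra operator `(Vx)_k = x_k (1 + (Ax)_k)` associated with the canonical
third-class skew-symmetric matrix with rows `(0, a12, a13, -a14)`, `(-a12, 0, a23, a24)`,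
`(-a13, -a23, 0, a34)`, `(a14, -a24, -a34, 0)`. -/
noncomputable def volterra3 (a12 a13 a14 a23 a24 a34 : ℝ)
    (x : Fin 4 → ℝ) : Fin 4 → ℝ :=
  ![x 0 * (1 + (a12 * x 1 + a13 * x 2 + -a14 * x 3)),
    x 1 * (1 + (-a12 * x 0 + a23 * x 2 + a24 * x 3)),
    x 2 * (1 + (-a13 * x 0 + -a23 * x 1 + a34 * x 3)),
    x 3 * (1 + (a14 * x 0 + -a24 * x 1 + -a34 * x 2))]

/-- `φ(x) = max{x₁x₂x₄, x₁x₃x₄}`. -/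
noncomputable def phi3 (y : Fin 4 → ℝ) : ℝ :=
  max (y 0 * y 1 * y 3) (y 0 * y 2 * y 3)

open Filter Topology

/-- If from every late time on there is a block of bounded length in which the proportion of times
satisfying `p` is at most `δ`, then `Nat.count p n` exceeds `δ * n` by a bounded amount. -/
theorem count_le_of_blocks (p : ℕ → Prop) [DecidablePred p] {δ : ℝ} (hδ : 0 ≤ δ) {N B : ℕ}
    (h : ∀ n ≥ N, ∃ M, 1 ≤ M ∧ M ≤ B ∧ (Nat.count (fun k => p (n + k)) M : ℝ) ≤ δ * M) (n : ℕ) :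
    (Nat.count p n : ℝ) ≤ N + B + δ * n := by
  have key : ∀ m, ∀ n ≥ N, (Nat.count (fun k => p (n + k)) m : ℝ) ≤ B + δ * m := by
    intro m
    induction m using Nat.strong_induction_on with
    | _ m ih =>
      intro n hn
      rcases le_total m B with hm | hm
      · have h1 : (Nat.count (fun k => p (n + k)) m : ℝ) ≤ m := by exact_mod_cast Nat.count_le _
        have h2 : (m : ℝ) ≤ B := by exact_mod_cast hm
        have h3 : 0 ≤ δ * m := by positivity
        linarith
      · obtain ⟨M, hM1, hMB, hM⟩ := h n hn
        obtain ⟨r, rfl⟩ := Nat.exists_eq_add_of_le (hMB.trans hm)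
        have hr := ih r (by omega) (n + M) (by omega)
        rw [Nat.count_add]
        simp only [← add_assoc]
        push_cast
        linarith
  have hN : (0 : ℝ) ≤ N := N.cast_nonneg
  have hB : (0 : ℝ) ≤ B := B.cast_nonneg
  rcases le_total n N with hn | hn
  · have h1 : (Nat.count p n : ℝ) ≤ n := by exact_mod_cast Nat.count_le _
    have h2 : (n : ℝ) ≤ N := by exact_mod_cast hn
    have h3 : 0 ≤ δ * n := by positivity
    linarith
  · obtain ⟨r, rfl⟩ := Nat.exists_eq_add_of_le hn
    have h1 : (Nat.count p N : ℝ) ≤ N := by exact_mod_cast Nat.count_le _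
    have h2 := key r N le_rfl
    have h3 : 0 ≤ δ * N := by positivity
    rw [Nat.count_add]
    push_cast
    linarith

open scoped Classical in
/-- If every limit point of a precompact orbit eventually leaves a closed set `C` forever, then the
orbit visits `C` with asymptotic frequency zero. -/
theorem tendsto_visit_frequency_zero {X : Type*} [TopologicalSpace X] {V : X → X}
    (hV : Continuous V) {K C : Set X} (hK : IsCompact K) (hC : IsClosed C) {x : X}
    (hx : ∀ n, V^[n] x ∈ K)
    (hL : ∀ y ∈ K, MapClusterPt y atTop (fun n => V^[n] x) → ∀ᶠ k in atTop, V^[k] y ∉ C) :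
    Tendsto (fun n : ℕ => (Nat.count (fun k => V^[k] x ∈ C) n : ℝ) / n) atTop (𝓝 0) := by
  have blocks : ∀ δ : ℝ, 0 < δ → ∃ B : ℕ, ∀ᶠ n in atTop, V^[n] x ∈ K → ∃ M, 1 ≤ M ∧ M ≤ B ∧
      (Nat.count (fun k => V^[n + k] x ∈ C) M : ℝ) ≤ δ * M := by
    intro δ hδ
    refine hK.induction_on
      (p := fun s => ∃ B : ℕ, ∀ᶠ n in atTop, V^[n] x ∈ s → ∃ M, 1 ≤ M ∧ M ≤ B ∧
        (Nat.count (fun k => V^[n + k] x ∈ C) M : ℝ) ≤ δ * M) ⟨0, by simp⟩ ?_ ?_ ?_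
    · rintro s t hst ⟨B, hB⟩
      exact ⟨B, hB.mono fun n hn h => hn (hst h)⟩
    · rintro s t ⟨B, hB⟩ ⟨B', hB'⟩
      refine ⟨max B B', ?_⟩
      filter_upwards [hB, hB'] with n hn hn' h
      rcases h with h | h
      · obtain ⟨M, h1, h2, h3⟩ := hn h
        exact ⟨M, h1, h2.trans (le_max_left _ _), h3⟩
      · obtain ⟨M, h1, h2, h3⟩ := hn' h
        exact ⟨M, h1, h2.trans (le_max_right _ _), h3⟩
    · intro y hy
      by_cases hc : MapClusterPt y atTop (fun n => V^[n] x)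
      · obtain ⟨N, hN⟩ := eventually_atTop.1 (hL y hy hc)
        obtain ⟨M, hM⟩ := exists_nat_gt (N / δ)
        have hMN : (N : ℝ) ≤ δ * M := by
          rw [div_lt_iff₀ hδ] at hM
          linarith
        have hM1 : 1 ≤ M := by
          have : (0 : ℝ) < M := lt_of_le_of_lt (by positivity) hM
          exact_mod_cast this
        have hev : ∀ᶠ z in 𝓝 y, ∀ k ∈ Finset.Ico N M, V^[k] z ∉ C := by
          rw [Filter.eventually_all_finset]
          intro k hk
          exact (hV.iterate k).continuousAt.eventually
            (hC.isOpen_compl.mem_nhds (hN k (Finset.mem_Ico.1 hk).1))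
        refine ⟨_, mem_nhdsWithin_of_mem_nhds hev, M, .of_forall fun n hn =>
          ⟨M, hM1, le_rfl, le_trans ?_ hMN⟩⟩
        rw [Nat.count_eq_card_filter_range]
        have hsub : (Finset.range M).filter (fun k => V^[n + k] x ∈ C) ⊆ Finset.range N := by
          intro k hk
          rw [Finset.mem_filter, Finset.mem_range] at hk
          rw [Finset.mem_range]
          by_contra hkN
          refine hn k (Finset.mem_Ico.2 ⟨not_lt.1 hkN, hk.1⟩) ?_
          rw [← Function.iterate_add_apply, add_comm]
          exact hk.2
        exact_mod_cast (Finset.card_le_card hsub).trans_eq (Finset.card_range N)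
      · rw [mapClusterPt_iff_frequently] at hc
        push Not at hc
        obtain ⟨s, hs, hfr⟩ := hc
        exact ⟨s, mem_nhdsWithin_of_mem_nhds hs, 0, hfr.mono fun n hn h => absurd h hn⟩
  rw [Metric.tendsto_atTop]
  intro η hη
  obtain ⟨B, hB⟩ := blocks (η / 2) (by positivity)
  obtain ⟨N, hN⟩ := eventually_atTop.1 hB
  obtain ⟨n₀, hn₀⟩ := exists_nat_gt ((N + B) / (η / 2))
  refine ⟨n₀, fun n hn => ?_⟩
  have hcount := count_le_of_blocks (fun k => V^[k] x ∈ C) (by positivity : 0 ≤ η / 2)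
    (fun m hm => hN m hm (hx m)) n
  have hn' : (N + B : ℝ) / (η / 2) < n := hn₀.trans_le (by exact_mod_cast hn)
  have hnpos : (0 : ℝ) < n := lt_of_le_of_lt (by positivity) hn'
  rw [div_lt_iff₀ (by positivity)] at hn'
  rw [Real.dist_eq, sub_zero, abs_of_nonneg (by positivity), div_lt_iff₀ hnpos]
  linarith

/-- A sequence in `(0, 1]` growing at least logistically converges to `1`. -/
theorem tendsto_one_of_logistic_growth {t : ℕ → ℝ} {c : ℝ} (hc : 0 < c) (h0 : 0 < t 0)
    (h1 : ∀ n, t n ≤ 1) (ht : ∀ n, t n * (1 + c * (1 - t n)) ≤ t (n + 1)) :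
    Tendsto t atTop (𝓝 1) := by
  have hpos : ∀ n, 0 < t n := by
    intro n
    induction n with
    | zero => exact h0
    | succ n ih =>
      have : 0 ≤ c * (1 - t n) := mul_nonneg hc.le (by linarith [h1 n])
      exact lt_of_lt_of_le (by positivity) (ht n)
  have hmono : Monotone t := monotone_nat_of_le_succ fun n => by
    have : 0 ≤ t n * (c * (1 - t n)) :=
      mul_nonneg (hpos n).le (mul_nonneg hc.le (by linarith [h1 n]))
    linarith [ht n]
  have hlim := tendsto_atTop_ciSup hmono ⟨1, by rintro _ ⟨n, rfl⟩; exact h1 n⟩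
  set l := ⨆ n, t n
  have hl0 : 0 < l := h0.trans_le (hmono.ge_of_tendsto hlim 0)
  have hl1 : l ≤ 1 := le_of_tendsto' hlim h1
  have hle : l * (1 + c * (1 - l)) ≤ l :=
    le_of_tendsto_of_tendsto' (hlim.mul ((((tendsto_const_nhds (x := (1 : ℝ))).sub hlim).const_mul
      c).const_add 1)) (hlim.comp (tendsto_add_atTop_nat 1)) ht
  have : l = 1 := by
    refine le_antisymm hl1 ?_
    by_contra hlt
    have : 0 < l * (c * (1 - l)) := mul_pos hl0 (mul_pos hc (by linarith))
    linarith
  rwa [this] at hlim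

theorem isCompact_simplex3 : IsCompact simplex3 := isCompact_stdSimplex ℝ (Fin 4)

theorem le_one_of_mem_simplex3 {y : Fin 4 → ℝ} (hy : y ∈ simplex3) (i : Fin 4) : y i ≤ 1 :=
  hy.2 ▸ Finset.single_le_sum (fun j _ => hy.1 j) (Finset.mem_univ i)

theorem continuous_volterra3 (a12 a13 a14 a23 a24 a34 : ℝ) :
    Continuous (volterra3 a12 a13 a14 a23 a24 a34) := by
  refine continuous_pi fun i => ?_
  fin_cases i <;> simp [volterra3] <;> fun_prop

theorem continuous_phi3 : Continuous phi3 := by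
  unfold phi3
  fun_prop

theorem volterra3_apply_eq_zero (a12 a13 a14 a23 a24 a34 : ℝ) {y : Fin 4 → ℝ} {i : Fin 4}
    (hi : y i = 0) : volterra3 a12 a13 a14 a23 a24 a34 y i = 0 := by
  fin_cases i <;> simp_all [volterra3]

section

variable {a12 a13 a14 a23 a24 a34 : ℝ}

theorem volterra3_mem_simplex3
    (h12 : a12 ∈ Set.Ioo (0 : ℝ) 1) (h13 : a13 ∈ Set.Ioo (0 : ℝ) 1)
    (h14 : a14 ∈ Set.Ioo (0 : ℝ) 1) (h23 : a23 ∈ Set.Ioo (0 : ℝ) 1)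
    (h24 : a24 ∈ Set.Ioo (0 : ℝ) 1) (h34 : a34 ∈ Set.Ioo (0 : ℝ) 1)
    {y : Fin 4 → ℝ} (hy : y ∈ simplex3) :
    volterra3 a12 a13 a14 a23 a24 a34 y ∈ simplex3 := by
  obtain ⟨hpos, hsum⟩ := hy
  rw [Fin.sum_univ_four] at hsum
  have hlow : ∀ {a : ℝ}, a ∈ Set.Ioo (0 : ℝ) 1 → ∀ i, 0 ≤ a * y i ∧ a * y i ≤ y i := fun ha i =>
    ⟨mul_nonneg ha.1.le (hpos i), mul_le_of_le_one_left (hpos i) ha.2.le⟩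
  refine ⟨fun i => ?_, ?_⟩
  · fin_cases i
    · refine mul_nonneg (hpos 0) ?_
      linarith [hlow h12 1, hlow h13 2, hlow h14 3, hpos 0, hpos 1, hpos 2]
    · refine mul_nonneg (hpos 1) ?_
      linarith [hlow h12 0, hlow h23 2, hlow h24 3, hpos 1, hpos 2, hpos 3]
    · refine mul_nonneg (hpos 2) ?_
      linarith [hlow h13 0, hlow h23 1, hlow h34 3, hpos 2, hpos 3]
    · refine mul_nonneg (hpos 3) ?_
      linarith [hlow h14 0, hlow h24 1, hlow h34 2, hpos 0, hpos 3]
  · rw [Fin.sum_univ_four]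
    simp only [volterra3, Matrix.cons_val]
    linear_combination hsum

/-- At a zero of `phi3` some positive coordinate grows at least logistically under the Volterra
operator, uniformly over the smallest face containing the point. -/
theorem exists_growing_coordinate
    (h12 : 0 < a12) (h13 : 0 < a13) (h14 : 0 < a14) (h23 : 0 < a23) (h24 : 0 < a24) (h34 : 0 < a34)
    {y : Fin 4 → ℝ} (hy : y ∈ simplex3) (hφ : phi3 y = 0) :
    ∃ i, 0 < y i ∧ ∃ c > 0, ∀ z ∈ simplex3, (∀ j, y j = 0 → z j = 0) →
      z i * (1 + c * (1 - z i)) ≤ volterra3 a12 a13 a14 a23 a24 a34 z i := by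
  obtain ⟨c, hc, l12, l13, l14, l23, l24, l34⟩ : ∃ c > 0, c ≤ a12 ∧ c ≤ a13 ∧ c ≤ a14 ∧ c ≤ a23 ∧
      c ≤ a24 ∧ c ≤ a34 :=
    ⟨min (min a12 (min a13 a14)) (min a23 (min a24 a34)), by simp [*], by simp, by simp, by simp,
      by simp, by simp, by simp⟩
  have hmul : ∀ {a : ℝ}, c ≤ a → ∀ z ∈ simplex3, ∀ i, c * z i ≤ a * z i := fun ha z hz i =>
    mul_le_mul_of_nonneg_right ha (hz.1 i)
  have grow0 : y 3 = 0 → ∀ z ∈ simplex3, (∀ j, y j = 0 → z j = 0) →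
      z 0 * (1 + c * (1 - z 0)) ≤ volterra3 a12 a13 a14 a23 a24 a34 z 0 := by
    intro h3 z hz hzero
    have hs := hz.2
    rw [Fin.sum_univ_four, hzero 3 h3] at hs
    refine mul_le_mul_of_nonneg_left ?_ (hz.1 0)
    rw [hzero 3 h3, show 1 - z 0 = z 1 + z 2 by linarith]
    linarith [hmul l12 z hz 1, hmul l13 z hz 2]
  have grow1 : y 0 = 0 → ∀ z ∈ simplex3, (∀ j, y j = 0 → z j = 0) →
      z 1 * (1 + c * (1 - z 1)) ≤ volterra3 a12 a13 a14 a23 a24 a34 z 1 := by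
    intro h0 z hz hzero
    have hs := hz.2
    rw [Fin.sum_univ_four, hzero 0 h0] at hs
    refine mul_le_mul_of_nonneg_left ?_ (hz.1 1)
    rw [hzero 0 h0, show 1 - z 1 = z 2 + z 3 by linarith]
    linarith [hmul l23 z hz 2, hmul l24 z hz 3]
  have grow2 : y 0 = 0 → y 1 = 0 → ∀ z ∈ simplex3, (∀ j, y j = 0 → z j = 0) →
      z 2 * (1 + c * (1 - z 2)) ≤ volterra3 a12 a13 a14 a23 a24 a34 z 2 := by
    intro h0 h1 z hz hzero
    have hs := hz.2
    rw [Fin.sum_univ_four, hzero 0 h0, hzero 1 h1] at hs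
    refine mul_le_mul_of_nonneg_left ?_ (hz.1 2)
    rw [hzero 0 h0, hzero 1 h1, show 1 - z 2 = z 3 by linarith]
    linarith [hmul l34 z hz 3]
  have grow3 : y 1 = 0 → y 2 = 0 → ∀ z ∈ simplex3, (∀ j, y j = 0 → z j = 0) →
      z 3 * (1 + c * (1 - z 3)) ≤ volterra3 a12 a13 a14 a23 a24 a34 z 3 := by
    intro h1 h2 z hz hzero
    have hs := hz.2
    rw [Fin.sum_univ_four, hzero 1 h1, hzero 2 h2] at hs
    refine mul_le_mul_of_nonneg_left ?_ (hz.1 3)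
    rw [hzero 1 h1, hzero 2 h2, show 1 - z 3 = z 0 by linarith]
    linarith [hmul l14 z hz 0]
  have hsum := hy.2
  rw [Fin.sum_univ_four] at hsum
  rcases (hy.1 0).eq_or_lt' with y0 | y0
  · rcases (hy.1 1).eq_or_lt' with y1 | y1
    · rcases (hy.1 2).eq_or_lt' with y2 | y2
      · exact ⟨3, by linarith, c, hc, grow3 y1 y2⟩
      · exact ⟨2, y2, c, hc, grow2 y0 y1⟩
    · exact ⟨1, y1, c, hc, grow1 y0⟩
  · rcases (hy.1 3).eq_or_lt' with y3 | y3
    · exact ⟨0, y0, c, hc, grow0 y3⟩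
    · have hpos : 0 < y 0 * y 3 := mul_pos y0 y3
      have y1 : y 1 = 0 := by
        refine le_antisymm (nonpos_of_mul_nonpos_right ?_ hpos) (hy.1 1)
        linarith [(le_max_left _ _).trans_eq hφ]
      have y2 : y 2 = 0 := by
        refine le_antisymm (nonpos_of_mul_nonpos_right ?_ hpos) (hy.1 2)
        linarith [(le_max_right _ _).trans_eq hφ]
      exact ⟨3, y3, c, hc, grow3 y1 y2⟩

end

open scoped Classical in
/-- If `x` is interior with `φ(Vⁿx) → 0`, then for all sufficiently small
`ε > 0` the average time spent outside the `ε`-neighborhoods of the four vertices is 0. -/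
theorem stmt_18 (a12 a13 a14 a23 a24 a34 : ℝ)
    (h12 : a12 ∈ Set.Ioo (0 : ℝ) 1) (h13 : a13 ∈ Set.Ioo (0 : ℝ) 1)
    (h14 : a14 ∈ Set.Ioo (0 : ℝ) 1) (h23 : a23 ∈ Set.Ioo (0 : ℝ) 1)
    (h24 : a24 ∈ Set.Ioo (0 : ℝ) 1) (h34 : a34 ∈ Set.Ioo (0 : ℝ) 1)
    (V : (Fin 4 → ℝ) → (Fin 4 → ℝ)) (hV : V = volterra3 a12 a13 a14 a23 a24 a34)
    (x : Fin 4 → ℝ) (hx : x ∈ simplex3) (hxpos : ∀ i, 0 < x i)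
    (hφ : Filter.Tendsto (fun n : ℕ => phi3 (V^[n] x)) Filter.atTop (nhds 0)) :
    ∃ ε₁ > (0 : ℝ), ∀ ε : ℝ, 0 < ε → ε ≤ ε₁ →
      Filter.Tendsto
        (fun n : ℕ =>
          (((Finset.range n).filter (fun k => ∀ i, V^[k] x i < 1 - ε)).card : ℝ) / n)
        Filter.atTop (nhds 0) := by
  refine ⟨1, one_pos, fun ε hε _ => ?_⟩
  have hcont : Continuous V := hV ▸ continuous_volterra3 a12 a13 a14 a23 a24 a34
  have hmaps : ∀ y ∈ simplex3, V y ∈ simplex3 := fun y hy =>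
    hV ▸ volterra3_mem_simplex3 h12 h13 h14 h23 h24 h34 hy
  have hiter : ∀ y ∈ simplex3, ∀ n, V^[n] y ∈ simplex3 := fun y hy n =>
    (show Set.MapsTo V simplex3 simplex3 from hmaps).iterate n hy
  have hclosed : IsClosed {y : Fin 4 → ℝ | ∀ i, y i ≤ 1 - ε} := by
    simp only [Set.ofPred_forall]
    exact isClosed_iInter fun i => isClosed_le (continuous_apply i) continuous_const
  have hfreq := tendsto_visit_frequency_zero hcont isCompact_simplex3 hclosed (hiter x hx) <| by
    intro y hy hcl
    have hφy : phi3 y = 0 := by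
      have hcl' : MapClusterPt (phi3 y) atTop (fun n => phi3 (V^[n] x)) :=
        hcl.continuousAt_comp continuous_phi3.continuousAt
      have : (𝓝 (phi3 y) ⊓ 𝓝 0).NeBot := hcl'.neBot.mono (inf_le_inf_left _ hφ)
      exact eq_of_nhds_neBot this
    obtain ⟨i, hi, c, hc, hgrow⟩ :=
      exists_growing_coordinate h12.1 h13.1 h14.1 h23.1 h24.1 h34.1 hy hφy
    have hzero : ∀ n j, y j = 0 → V^[n] y j = 0 := by
      intro n j hj
      induction n with
      | zero => exact hj
      | succ n ih =>
        rw [Function.iterate_succ_apply', hV]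
        rw [hV] at ih
        exact volterra3_apply_eq_zero _ _ _ _ _ _ ih
    have hlim : Tendsto (fun n => V^[n] y i) atTop (𝓝 1) := by
      refine tendsto_one_of_logistic_growth hc hi
        (fun n => le_one_of_mem_simplex3 (hiter y hy n) i) fun n => ?_
      rw [Function.iterate_succ_apply']
      have := hgrow _ (hiter y hy n) (hzero n)
      rwa [← hV] at this
    filter_upwards [hlim.eventually (lt_mem_nhds (by linarith : 1 - ε < 1))] with k hk hmem
    exact (hmem i).not_gt hk
  refine squeeze_zero (fun n => by positivity) (fun n => ?_) hfreq
  rw [Nat.count_eq_card_filter_range]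
  gcongr with k hk
  exact fun h i => (h i).le
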